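/- Let n, m, d be positive integers with m(m−1) ≤ 2^n/100 and 2^{n−d} ≥ 18·ln(200·3^n). Say a distribution D* on {±1}^n robustly requires depth d if for every distribution D' with d_TV(D*, D') ≤ 1/3 and every decision tree T of depth at most d, the probability mass function of D' is not constant on every leaf of T. Then there is no function A : ({±1}^n)^m → [0,1] (interpreting A(y) as the probability that a tester outputs 'uniform' on input sample y) such that both of the following hold: (i) E_{y ~ Unif({±1}^n)^m}[A(y)] ≥ 2/3; and (ii) for every distribution D* on {±1}^n that robustly requires depth d, E_{y ~ (D*)^m}[1 − A(y)] ≥ 2/3. -/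

import Mathlib

open scoped Classical

/-- Points of the cube `{±1}^n`, encoded as `Fin n → Bool`. -/
abbrev Cube (n : ℕ) := Fin n → Bool

/-- Restrictions `ρ ∈ {±1,⋆}^n`, with `none` playing the role of `⋆`. -/
abbrev Rst (n : ℕ) := Fin n → Option Bool

/-- Labeled examples. -/
abbrev Lab (n : ℕ) := Cube n × Bool

/-- `x` is consistent with the restriction `ρ`. -/
def Consistent {n : ℕ} (x : Cube n) (ρ : Rst n) : Prop :=
  ∀ i : Fin n, ∀ b : Bool, ρ i = some b → x i = b

/-- The depth (number of non-⋆ coordinates) of a restriction. -/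
def rdepth {n : ℕ} (ρ : Rst n) : ℕ :=
  (Finset.univ.filter (fun i => ρ i ≠ none)).card

/-- `IsDT n d T` : `T` is the set of leaf restrictions of a depth-`d` decision tree over `{±1}^n`. -/
inductive IsDT (n : ℕ) : ℕ → Finset (Rst n) → Prop
  | leaf : IsDT n 0 {fun _ => none}
  | node {d : ℕ} (i : Fin n) {T₀ T₁ : Finset (Rst n)} :
      IsDT n d T₀ → IsDT n d T₁ →
      (∀ ℓ ∈ T₀, ℓ i = none) → (∀ ℓ ∈ T₁, ℓ i = none) →
      IsDT n (d + 1)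
        (T₀.image (fun ℓ => Function.update ℓ i (some false)) ∪
         T₁.image (fun ℓ => Function.update ℓ i (some true)))

/-- Empirical error of a hypothesis on a labeled multiset. -/
noncomputable def errS {n : ℕ} (h : Cube n → Bool) (S : Multiset (Lab n)) : ℝ :=
  ((S.filter (fun p => h p.1 ≠ p.2)).card : ℝ) / (S.card : ℝ)

/-- Empirical error of a partial (`Option Bool`-valued) hypothesis on a labeled multiset;
`⊥ = none` always counts as a misclassification. -/
noncomputable def errSo {n : ℕ} (h : Cube n → Option Bool) (S : Multiset (Lab n)) : ℝ :=
  ((S.filter (fun p => h p.1 ≠ some p.2)).card : ℝ) / (S.card : ℝ)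

/-- True error of a hypothesis with respect to a distribution on labeled examples. -/
noncomputable def errD {n : ℕ} (h : Cube n → Bool) (D : Lab n → ℝ) : ℝ :=
  ∑ p : Lab n, if h p.1 ≠ p.2 then D p else 0

/-- True error of a partial hypothesis with respect to a distribution on labeled examples. -/
noncomputable def errDo {n : ℕ} (h : Cube n → Option Bool) (D : Lab n → ℝ) : ℝ :=
  ∑ p : Lab n, if h p.1 ≠ some p.2 then D p else 0

/-- The multiset of samples of a tuple. -/
def toMS {α : Type*} {m : ℕ} (y : Fin m → α) : Multiset α := ↑(List.ofFn y)

/-- `T ∘ H` : the decision-tree-composed hypothesis. -/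
noncomputable def treeHyp {n : ℕ} (T : Finset (Rst n)) (H : Rst n → Cube n → Bool)
    (x : Cube n) : Bool :=
  if h : ∃ ℓ, ℓ ∈ T ∧ Consistent x ℓ then H h.choose x else false

/-- `P ∘ H` : the subcube-partition-composed hypothesis (`none` = ⊥ off the partition). -/
noncomputable def partHyp {n s : ℕ} (ρ : Fin s → Rst n) (H : Rst n → Cube n → Bool)
    (x : Cube n) : Option Bool :=
  if h : ∃ i, Consistent x (ρ i) then some (H (ρ h.choose) x) else none

/-- `L ∘ H` : the subcube-list-composed hypothesis (first consistent subcube wins). -/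
noncomputable def listHyp {n : ℕ} (H : Rst n → Cube n → Bool) :
    List (Rst n) → Cube n → Option Bool
  | [], _ => none
  | π :: L, x => if Consistent x π then some (H π x) else listHyp H L x

/-- Mass of a distribution on the subcube of a restriction. -/
noncomputable def rmass {n : ℕ} (D : Cube n → ℝ) (ρ : Rst n) : ℝ :=
  ∑ x ∈ Finset.univ.filter (fun x => Consistent x ρ), D x

/-- `D` conditioned on the subcube of the restriction `ρ`. -/
noncomputable def condD {n : ℕ} (D : Cube n → ℝ) (ρ : Rst n) : Cube n → ℝ :=
  fun x => if Consistent x ρ then D x / rmass D ρ else 0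

/-- The labeled distribution `D_f` of `(x, f(x))`, `x ~ D`. -/
def labD {n : ℕ} (D : Cube n → ℝ) (f : Cube n → Bool) : Lab n → ℝ :=
  fun p => if p.2 = f p.1 then D p.1 else 0

/-- `D'` has constant probability mass function on every leaf of `T`. -/
def ConstOnLeaves {n : ℕ} (D' : Cube n → ℝ) (T : Finset (Rst n)) : Prop :=
  ∀ ℓ ∈ T, ∀ x x' : Cube n, Consistent x ℓ → Consistent x' ℓ → D' x = D' x'

/-- `D` robustly requires depth `d`: no distribution within TV distance 1/3 of `D`
is constant on the leaves of any decision tree of depth at most `d`. -/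
def RobustlyRequiresDepth (n : ℕ) (D : Cube n → ℝ) (d : ℕ) : Prop :=
  ∀ D' : Cube n → ℝ, (∀ x, 0 ≤ D' x) → (∑ x : Cube n, D' x = 1) →
    (1 / 2 : ℝ) * (∑ x : Cube n, |D x - D' x|) ≤ 1 / 3 →
    ∀ d' ≤ d, ∀ T : Finset (Rst n), IsDT n d' T → ¬ ConstOnLeaves D' T

namespace DepthLB

/-- The sign of a bit. -/
noncomputable def sg (b : Bool) : ℝ := if b then 1 else -1

/-- Forget the value of coordinate `i0`. -/
def canon {n : ℕ} (i0 : Fin n) (x : Cube n) : Cube n := Function.update x i0 false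

/-- Flip coordinate `i0`. -/
def flp {n : ℕ} (i0 : Fin n) (x : Cube n) : Cube n := Function.update x i0 (!(x i0))

/-- `+1` on the random half, `-1` off it. -/
noncomputable def ep {n : ℕ} (i0 : Fin n) (f : Cube n → Bool) (x : Cube n) : ℝ :=
  sg (x i0) * sg (f (canon i0 x))

/-- The hard distribution. -/
noncomputable def DD {n : ℕ} (i0 : Fin n) (f : Cube n → Bool) (x : Cube n) : ℝ :=
  (1 + ep i0 f x) / 2 ^ n

/-- Points of a subcube. -/
noncomputable def sub {n : ℕ} (ρ : Rst n) : Finset (Cube n) :=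
  Finset.univ.filter (fun x => Consistent x ρ)

lemma ep_cases {n : ℕ} (i0 : Fin n) (f : Cube n → Bool) (x : Cube n) :
    ep i0 f x = 1 ∨ ep i0 f x = -1 := by
  unfold ep sg
  split_ifs <;> norm_num

/-- Independence of the bits of a random function at distinct points. -/
lemma indep {α ι : Type*} [Fintype α] [DecidableEq α] [Fintype ι]
    (z : ι → α) (hz : Function.Injective z) (h : ι → Bool → ℝ) :
    ∑ f : α → Bool, ∏ i, h i (f (z i))
      = (Fintype.card (α → Bool) : ℝ) * ∏ i, ((h i true + h i false) / 2) := by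
  have h1 : ∀ f : α → Bool, ∏ i, h i (f (z i))
      = ∏ a, ∏ i, (if z i = a then h i (f a) else 1) := by
    intro f
    rw [Finset.prod_comm]
    refine Finset.prod_congr rfl fun i _ => ?_
    simp
  have h2 : ∏ i, ((h i true + h i false) / 2)
      = ∏ a, ∏ i, (if z i = a then ((h i true + h i false) / 2) else 1) := by
    rw [Finset.prod_comm]
    refine Finset.prod_congr rfl fun i _ => ?_
    simp
  simp_rw [h1]
  rw [h2]
  have h3 := Finset.prod_univ_sum (fun _ : α => (Finset.univ : Finset Bool))
    (fun a b => ∏ i, (if z i = a then h i b else 1))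
  simp only [Fintype.piFinset_univ] at h3
  rw [← h3]
  have hc : (Fintype.card (α → Bool) : ℝ) = ∏ _a : α, (2 : ℝ) := by simp
  rw [hc, ← Finset.prod_mul_distrib]
  refine Finset.prod_congr rfl fun a _ => ?_
  by_cases ha : ∃ i, z i = a
  · obtain ⟨i, rfl⟩ := ha
    have : ∀ g : ι → ℝ, ∏ j, (if z j = z i then g j else 1) = g i := by
      intro g
      rw [Finset.prod_eq_single i]
      · simp
      · intro j _ hj
        rw [if_neg (fun h => hj (hz h))]
      · simp
    simp only [this, Fintype.sum_bool]
    ring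
  · have : ∀ g : ι → ℝ, ∏ j, (if z j = a then g j else 1) = 1 := by
      intro g
      refine Finset.prod_eq_one fun j _ => ?_
      rw [if_neg (fun h => ha ⟨j, h⟩)]
    simp only [this, Fintype.sum_bool]
    norm_num

lemma canon_eq {n : ℕ} (i0 : Fin n) {x y : Cube n} (h : canon i0 x = canon i0 y)
    (h0 : x i0 = y i0) : x = y := by
  funext i
  by_cases hi : i = i0
  · subst hi; exact h0
  · have := congrFun h i
    simpa [canon, hi] using this

lemma exp_markov {n : ℕ} (i0 : Fin n) (ρ : Rst n) (h0 : ρ i0 ≠ none) (t : ℝ) :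
    ∑ f : Cube n → Bool, Real.exp (t * ∑ x ∈ sub ρ, ep i0 f x)
      = (Fintype.card (Cube n → Bool) : ℝ) * Real.cosh t ^ (sub ρ).card := by
  have hinj : Function.Injective (fun x : {x // x ∈ sub ρ} => canon i0 x.1) := by
    intro x y hxy
    apply Subtype.ext
    obtain ⟨b, hb⟩ := Option.ne_none_iff_exists'.1 h0
    have hx := x.2
    have hy := y.2
    simp only [sub, Finset.mem_filter, Finset.mem_univ, true_and] at hx hy
    exact canon_eq i0 hxy ((hx i0 b hb).trans (hy i0 b hb).symm)
  have := indep _ hinj (fun x b => Real.exp (t * (sg (x.1 i0) * sg b)))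
  have hl : ∀ f : Cube n → Bool, Real.exp (t * ∑ x ∈ sub ρ, ep i0 f x)
      = ∏ x : {x // x ∈ sub ρ}, Real.exp (t * (sg (x.1 i0) * sg (f (canon i0 x.1)))) := by
    intro f
    rw [← Real.exp_sum, Finset.mul_sum, ← Finset.sum_coe_sort]
    rfl
  simp_rw [hl]
  rw [this]
  congr 1
  have : ∀ x : {x // x ∈ sub ρ}, (Real.exp (t * (sg (x.1 i0) * sg true))
      + Real.exp (t * (sg (x.1 i0) * sg false))) / 2 = Real.cosh t := by
    intro x
    rw [Real.cosh_eq]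
    unfold sg
    cases x.1 i0 <;> simp [add_comm]
  simp [this]

lemma tail_one {n : ℕ} (i0 : Fin n) (ρ : Rst n) (h0 : ρ i0 ≠ none) (s : ℝ) (hs : s ^ 2 = 1) :
    ((Finset.univ.filter (fun f : Cube n → Bool =>
      ((sub ρ).card : ℝ) / 3 ≤ s * ∑ x ∈ sub ρ, ep i0 f x)).card : ℝ)
      ≤ (Fintype.card (Cube n → Bool) : ℝ) * Real.exp (-((sub ρ).card : ℝ) / 18) := by
  set L : ℝ := ((sub ρ).card : ℝ) with hL
  have h1 := exp_markov i0 ρ h0 (s / 3)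
  set B := Finset.univ.filter (fun f : Cube n → Bool => L / 3 ≤ s * ∑ x ∈ sub ρ, ep i0 f x)
  have h2 : (B.card : ℝ) * Real.exp (L / 9)
      ≤ ∑ f : Cube n → Bool, Real.exp (s / 3 * ∑ x ∈ sub ρ, ep i0 f x) := by
    calc (B.card : ℝ) * Real.exp (L / 9) = ∑ f ∈ B, Real.exp (L / 9) := by simp
      _ ≤ ∑ f ∈ B, Real.exp (s / 3 * ∑ x ∈ sub ρ, ep i0 f x) := by
          refine Finset.sum_le_sum fun f hf => ?_
          apply Real.exp_le_exp.2
          have := (Finset.mem_filter.1 hf).2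
          linarith
      _ ≤ _ := Finset.sum_le_sum_of_subset_of_nonneg (Finset.subset_univ _)
          (fun _ _ _ => (Real.exp_pos _).le)
  have h3 : Real.cosh (s / 3) ^ (sub ρ).card ≤ Real.exp (L / 18) := by
    calc Real.cosh (s / 3) ^ (sub ρ).card ≤ (Real.exp ((s / 3) ^ 2 / 2)) ^ (sub ρ).card :=
          pow_le_pow_left₀ (Real.cosh_pos _).le (Real.cosh_le_exp_half_sq _) _
      _ = Real.exp (L / 18) := by
          rw [← Real.exp_nat_mul]
          congr 1
          rw [div_pow, hs, ← hL]; ring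
  rw [h1] at h2
  have h4 : (B.card : ℝ) * Real.exp (L / 9)
      ≤ (Fintype.card (Cube n → Bool) : ℝ) * Real.exp (L / 18) :=
    h2.trans (mul_le_mul_of_nonneg_left h3 (Nat.cast_nonneg _))
  have h5 : Real.exp (L / 18) = Real.exp (-L / 18) * Real.exp (L / 9) := by
    rw [← Real.exp_add]; congr 1; ring
  rw [h5, ← mul_assoc] at h4
  exact le_of_mul_le_mul_right h4 (Real.exp_pos _)

lemma sum_ep_free {n : ℕ} (i0 : Fin n) (ρ : Rst n) (h0 : ρ i0 = none) (f : Cube n → Bool) :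
    ∑ x ∈ sub ρ, ep i0 f x = 0 := by
  have hflp : ∀ x, flp i0 (flp i0 x) = x := by
    intro x; unfold flp; simp
  have hmem : ∀ x ∈ sub ρ, flp i0 x ∈ sub ρ := by
    intro x hx
    simp only [sub, Finset.mem_filter, Finset.mem_univ, true_and] at hx ⊢
    intro i b hb
    have hi : i ≠ i0 := by rintro rfl; simp [h0] at hb
    simp [flp, hi, hx i b hb]
  have hneg : ∀ x, ep i0 f (flp i0 x) = - ep i0 f x := by
    intro x
    have : canon i0 (flp i0 x) = canon i0 x := by simp [canon, flp]
    simp only [ep, this]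
    have : (flp i0 x) i0 = !(x i0) := by simp [flp]
    rw [this]
    have hs : sg (!(x i0)) = - sg (x i0) := by unfold sg; cases x i0 <;> simp
    rw [hs]; ring
  have : ∑ x ∈ sub ρ, ep i0 f x = ∑ x ∈ sub ρ, - ep i0 f x := by
    refine Finset.sum_bij' (fun x _ => flp i0 x) (fun x _ => flp i0 x) hmem hmem
      (fun x _ => hflp x) (fun x _ => hflp x) ?_
    intro x _
    rw [hneg]; ring
  rw [Finset.sum_neg_distrib] at this
  linarith

lemma card_sub {n : ℕ} (ρ : Rst n) : (sub ρ).card = 2 ^ (n - rdepth ρ) := by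
  have : sub ρ = Fintype.piFinset (fun i : Fin n =>
      if ρ i ≠ none then Finset.univ.filter (fun b => ρ i = some b) else Finset.univ) := by
    ext x
    simp only [sub, Finset.mem_filter, Finset.mem_univ, true_and, Fintype.mem_piFinset]
    refine forall_congr' fun i => ?_
    cases h : ρ i with
    | none => simp
    | some c =>
      simp only [Option.some.injEq, ne_eq, reduceCtorEq, not_false_eq_true, if_true,
        Finset.mem_filter, Finset.mem_univ, true_and]
      exact ⟨fun h => (h c rfl).symm, fun h b hb => by rw [← hb, h]⟩
  rw [this, Fintype.card_piFinset]
  have h2 : ∀ i : Fin n, (if ρ i ≠ none then Finset.univ.filter (fun b => ρ i = some b)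
      else (Finset.univ : Finset Bool)).card = if ρ i ≠ none then 1 else 2 := by
    intro i
    cases h : ρ i with
    | none => simp
    | some c => simp [Finset.filter_eq]
  simp_rw [h2]
  rw [Finset.prod_ite]
  simp only [Finset.prod_const, one_pow, one_mul]
  congr 1
  have := Finset.card_filter_add_card_filter_not (s := (Finset.univ : Finset (Fin n))) (fun i => ρ i ≠ none)
  simp only [Finset.card_univ, Fintype.card_fin] at this
  unfold rdepth
  omega

lemma rdepth_update {n : ℕ} (ρ : Rst n) (i : Fin n) (v : Option Bool) :
    rdepth (Function.update ρ i v) ≤ rdepth ρ + 1 := by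
  unfold rdepth
  refine (Finset.card_le_card (t := insert i (Finset.univ.filter (fun j => ρ j ≠ none))) ?_).trans
    (Finset.card_insert_le _ _)
  intro j hj
  by_cases h : j = i
  · simp [h]
  · simp only [Finset.mem_filter, Finset.mem_univ, true_and, Finset.mem_insert] at hj ⊢
    right
    simpa [h] using hj

lemma dt_depth {n d : ℕ} {T : Finset (Rst n)} (hT : IsDT n d T) : ∀ ℓ ∈ T, rdepth ℓ ≤ d := by
  induction hT with
  | leaf => intro ℓ hℓ; simp at hℓ; subst hℓ; simp [rdepth]
  | node i _ _ _ _ ih0 ih1 =>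
    intro ℓ hℓ
    simp only [Finset.mem_union, Finset.mem_image] at hℓ
    rcases hℓ with ⟨k, hk, rfl⟩ | ⟨k, hk, rfl⟩
    · exact (rdepth_update _ _ _).trans (Nat.succ_le_succ (ih0 k hk))
    · exact (rdepth_update _ _ _).trans (Nat.succ_le_succ (ih1 k hk))

lemma cons_update {n : ℕ} {x : Cube n} {ℓ : Rst n} {i : Fin n} {b : Bool} (h : ℓ i = none) :
    Consistent x (Function.update ℓ i (some b)) ↔ x i = b ∧ Consistent x ℓ := by
  constructor
  · intro hx
    refine ⟨hx i b (by simp), fun j c hj => ?_⟩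
    have hji : j ≠ i := by rintro rfl; simp [h] at hj
    exact hx j c (by simpa [hji] using hj)
  · rintro ⟨h1, h2⟩ j c hj
    by_cases hji : j = i
    · subst hji; simp at hj; rw [h1, hj]
    · exact h2 j c (by simpa [hji] using hj)

lemma dt_unique {n d : ℕ} {T : Finset (Rst n)} (hT : IsDT n d T) (x : Cube n) :
    ∃! ℓ, ℓ ∈ T ∧ Consistent x ℓ := by
  induction hT with
  | leaf =>
    refine ⟨fun _ => none, ⟨by simp, by intro i b h; simp at h⟩, ?_⟩
    rintro ℓ ⟨h, _⟩; simpa using h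
  | node i _ _ h0 h1 ih0 ih1 =>
    cases hx : x i with
    | false =>
      obtain ⟨ℓ, ⟨hℓ, hc⟩, hu⟩ := ih0
      refine ⟨Function.update ℓ i (some false), ⟨?_, (cons_update (h0 ℓ hℓ)).2 ⟨hx, hc⟩⟩, ?_⟩
      · exact Finset.mem_union_left _ (Finset.mem_image_of_mem _ hℓ)
      · rintro k ⟨hk, hkc⟩
        simp only [Finset.mem_union, Finset.mem_image] at hk
        rcases hk with ⟨k, hk, rfl⟩ | ⟨k, hk, rfl⟩
        · rw [hu k ⟨hk, ((cons_update (h0 k hk)).1 hkc).2⟩]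
        · have := ((cons_update (h1 k hk)).1 hkc).1
          rw [hx] at this; simp at this
    | true =>
      obtain ⟨ℓ, ⟨hℓ, hc⟩, hu⟩ := ih1
      refine ⟨Function.update ℓ i (some true), ⟨?_, (cons_update (h1 ℓ hℓ)).2 ⟨hx, hc⟩⟩, ?_⟩
      · exact Finset.mem_union_right _ (Finset.mem_image_of_mem _ hℓ)
      · rintro k ⟨hk, hkc⟩
        simp only [Finset.mem_union, Finset.mem_image] at hk
        rcases hk with ⟨k, hk, rfl⟩ | ⟨k, hk, rfl⟩
        · have := ((cons_update (h0 k hk)).1 hkc).1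
          rw [hx] at this; simp at this
        · rw [hu k ⟨hk, ((cons_update (h1 k hk)).1 hkc).2⟩]

lemma dt_sum {n d : ℕ} {T : Finset (Rst n)} (hT : IsDT n d T) (g : Cube n → ℝ) :
    ∑ x, g x = ∑ ℓ ∈ T, ∑ x ∈ sub ℓ, g x := by
  simp only [sub, Finset.sum_filter]
  rw [Finset.sum_comm]
  refine Finset.sum_congr rfl fun x _ => ?_
  obtain ⟨ℓ, ⟨hℓ, hc⟩, hu⟩ := dt_unique hT x
  rw [Finset.sum_eq_single ℓ]
  · simp [hc]
  · intro k hk hne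
    rw [if_neg (fun h => hne (hu k ⟨hk, h⟩))]
  · intro h; exact absurd hℓ h

lemma pointwise (e a : ℝ) (he : e = 1 ∨ e = -1) :
    1 - e * max (-1) (min 1 a) ≤ |e - a| := by
  rcases he with rfl | rfl <;> rcases max_cases (-1) (min 1 a) with h | h <;>
    rcases min_cases 1 a with h' | h' <;> first
    | (rcases abs_cases ((1 : ℝ) - a) with h'' | h'' <;> linarith)
    | (rcases abs_cases ((-1 : ℝ) - a) with h'' | h'' <;> linarith)

lemma leaf_bound {n : ℕ} (i0 : Fin n) (f : Cube n → Bool) (S : Finset (Cube n)) (c : ℝ)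
    (hS : |∑ x ∈ S, ep i0 f x| < (S.card : ℝ) / 3) :
    2 / 3 * (S.card : ℝ) / 2 ^ n < ∑ x ∈ S, |DD i0 f x - c| := by
  have hN : (0 : ℝ) < 2 ^ n := by positivity
  set a : ℝ := c * 2 ^ n - 1 with ha
  have h1 : ∀ x, |DD i0 f x - c| = |ep i0 f x - a| / 2 ^ n := by
    intro x
    have h2 : |ep i0 f x - a| / 2 ^ n = |(ep i0 f x - a) / 2 ^ n| := by
      rw [abs_div, abs_of_pos hN]
    rw [h2]
    congr 1
    rw [ha]; unfold DD; field_simp; ring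
  simp_rw [h1]
  rw [← Finset.sum_div]
  apply div_lt_div_of_pos_right _ hN
  set a' := max (-1) (min 1 a)
  have ha' : |a'| ≤ 1 := by
    rw [abs_le]
    exact ⟨le_max_left _ _, max_le (by norm_num) (min_le_left _ _)⟩
  calc 2 / 3 * (S.card : ℝ) < S.card - |∑ x ∈ S, ep i0 f x| := by linarith
    _ ≤ S.card - (∑ x ∈ S, ep i0 f x) * a' := by
        have : (∑ x ∈ S, ep i0 f x) * a' ≤ |∑ x ∈ S, ep i0 f x| := by
          calc _ ≤ |(∑ x ∈ S, ep i0 f x) * a'| := le_abs_self _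
            _ = |∑ x ∈ S, ep i0 f x| * |a'| := abs_mul _ _
            _ ≤ _ := mul_le_of_le_one_right (abs_nonneg _) ha'
        linarith
    _ = ∑ x ∈ S, (1 - ep i0 f x * a') := by
        rw [Finset.sum_sub_distrib, Finset.sum_mul]; simp
    _ ≤ _ := Finset.sum_le_sum fun x _ => pointwise _ _ (ep_cases i0 f x)

lemma robust {n d : ℕ} (i0 : Fin n) (f : Cube n → Bool)
    (hf : ∀ ρ : Rst n, rdepth ρ ≤ d → |∑ x ∈ sub ρ, ep i0 f x| < ((sub ρ).card : ℝ) / 3) :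
    RobustlyRequiresDepth n (DD i0 f) d := by
  intro D' _ _ hTV d' hd' T hT hconst
  have hne : T.Nonempty := by
    obtain ⟨ℓ, ⟨h, _⟩, _⟩ := dt_unique hT (fun _ => false)
    exact ⟨ℓ, h⟩
  have h1 : ∑ ℓ ∈ T, 2 / 3 * ((sub ℓ).card : ℝ) / 2 ^ n
      < ∑ ℓ ∈ T, ∑ x ∈ sub ℓ, |DD i0 f x - D' x| := by
    refine Finset.sum_lt_sum_of_nonempty hne fun ℓ hℓ => ?_
    have hpos : 0 < (sub ℓ).card := by rw [card_sub]; positivity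
    obtain ⟨x0, hx0⟩ := Finset.card_pos.1 hpos
    have := leaf_bound i0 f (sub ℓ) (D' x0) (hf ℓ ((dt_depth hT ℓ hℓ).trans hd'))
    refine this.trans_le (le_of_eq (Finset.sum_congr rfl fun x hx => ?_))
    rw [hconst ℓ hℓ x x0 (Finset.mem_filter.1 hx).2 (Finset.mem_filter.1 hx0).2]
  rw [← dt_sum hT] at h1
  have h2 := dt_sum hT (fun _ => (1 : ℝ))
  simp only [Finset.sum_const, nsmul_eq_mul, mul_one, Finset.card_univ] at h2
  rw [← Finset.sum_div, ← Finset.mul_sum, ← h2] at h1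
  simp only [Fintype.card_fun, Fintype.card_bool, Fintype.card_fin] at h1
  push_cast at h1
  rw [mul_div_assoc, div_self (by positivity)] at h1
  linarith

lemma bad_count {n d : ℕ} (i0 : Fin n)
    (hdepth : 18 * Real.log (200 * 3 ^ n) ≤ (2 : ℝ) ^ (n - d)) :
    ((Finset.univ.filter (fun f : Cube n → Bool => ¬ ∀ ρ : Rst n, rdepth ρ ≤ d →
      |∑ x ∈ sub ρ, ep i0 f x| < ((sub ρ).card : ℝ) / 3)).card : ℝ)
      ≤ (Fintype.card (Cube n → Bool) : ℝ) / 100 := by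
  set F : ℝ := (Fintype.card (Cube n → Bool) : ℝ) with hF
  have hF0 : 0 ≤ F := Nat.cast_nonneg _
  let B : Rst n → Finset (Cube n → Bool) := fun ρ => Finset.univ.filter (fun f =>
    rdepth ρ ≤ d ∧ ((sub ρ).card : ℝ) / 3 ≤ |∑ x ∈ sub ρ, ep i0 f x|)
  have hsub : (Finset.univ.filter (fun f : Cube n → Bool => ¬ ∀ ρ : Rst n, rdepth ρ ≤ d →
      |∑ x ∈ sub ρ, ep i0 f x| < ((sub ρ).card : ℝ) / 3)) ⊆ Finset.univ.biUnion B := by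
    intro f hf
    simp only [Finset.mem_filter, Finset.mem_univ, true_and, not_forall, not_lt] at hf
    obtain ⟨ρ, h1, h2⟩ := hf
    exact Finset.mem_biUnion.2 ⟨ρ, Finset.mem_univ _, by simp [B, h1, h2]⟩
  have hB : ∀ ρ, ((B ρ).card : ℝ) ≤ F * (2 / (200 * 3 ^ n)) := by
    intro ρ
    by_cases hρ : rdepth ρ ≤ d
    swap
    · have : B ρ = ∅ := by simp [B, hρ]
      rw [this]; simp; positivity
    by_cases h0 : ρ i0 = none
    · have : B ρ = ∅ := by
        have hpos : 0 < ((sub ρ).card : ℝ) := by rw [card_sub]; positivity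
        ext f
        simp only [B, sum_ep_free i0 ρ h0, Finset.mem_filter, abs_zero]
        simp
        intro _
        have := Nat.cast_pos.1 hpos
        exact Finset.card_pos.1 this
      rw [this]; simp; positivity
    have hL : 18 * Real.log (200 * 3 ^ n) ≤ ((sub ρ).card : ℝ) := by
      refine hdepth.trans ?_
      rw [card_sub]; push_cast
      exact pow_le_pow_right₀ (by norm_num) (by omega)
    have he : Real.exp (-((sub ρ).card : ℝ) / 18) ≤ 1 / (200 * 3 ^ n) := by
      calc _ ≤ Real.exp (- Real.log (200 * 3 ^ n)) := Real.exp_le_exp.2 (by linarith)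
        _ = _ := by rw [Real.exp_neg, Real.exp_log (by positivity), one_div]
    have t1 := tail_one i0 ρ h0 1 (by norm_num)
    have t2 := tail_one i0 ρ h0 (-1) (by norm_num)
    rw [← hF] at t1 t2
    have t3 := mul_le_mul_of_nonneg_left he hF0
    have hBs : B ρ ⊆ (Finset.univ.filter (fun f : Cube n → Bool =>
          ((sub ρ).card : ℝ) / 3 ≤ 1 * ∑ x ∈ sub ρ, ep i0 f x)) ∪
        (Finset.univ.filter (fun f : Cube n → Bool =>
          ((sub ρ).card : ℝ) / 3 ≤ (-1) * ∑ x ∈ sub ρ, ep i0 f x)) := by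
      intro f hf
      have := (Finset.mem_filter.1 hf).2.2
      rw [Finset.mem_union]
      rcases le_abs.1 this with h | h
      · left; simpa using h
      · right; simpa using h
    have t4 : ((B ρ).card : ℝ) ≤ _ := Nat.cast_le.2 ((Finset.card_le_card hBs).trans
      (Finset.card_union_le _ _))
    push_cast at t4
    have : F * (2 / (200 * 3 ^ n)) = F * (1 / (200 * 3 ^ n)) + F * (1 / (200 * 3 ^ n)) := by ring
    linarith
  calc _ ≤ ((Finset.univ.biUnion B).card : ℝ) := Nat.cast_le.2 (Finset.card_le_card hsub)
    _ ≤ ((∑ ρ, (B ρ).card : ℕ) : ℝ) := Nat.cast_le.2 Finset.card_biUnion_le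
    _ = ∑ ρ, ((B ρ).card : ℝ) := by push_cast; rfl
    _ ≤ ∑ ρ : Rst n, F * (2 / (200 * 3 ^ n)) := Finset.sum_le_sum fun ρ _ => hB ρ
    _ = F / 100 := by
      simp only [Finset.sum_const, nsmul_eq_mul, Finset.card_univ, Fintype.card_fun,
        Fintype.card_option, Fintype.card_bool, Fintype.card_fin]
      push_cast
      have : (3 : ℝ) ^ n ≠ 0 := by positivity
      norm_num
      field_simp
      ring

/-- Tuples with all pairs distinct are seen uniformly. -/
lemma distinct_avg {n m : ℕ} (i0 : Fin n) (y : Fin m → Cube n)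
    (hy : Function.Injective (fun i => canon i0 (y i))) :
    ∑ f : Cube n → Bool, ∏ i, DD i0 f (y i)
      = (Fintype.card (Cube n → Bool) : ℝ) * ∏ _i : Fin m, ((2 : ℝ) ^ n)⁻¹ := by
  have := indep _ hy (fun i b => (1 + sg (y i i0) * sg b) / 2 ^ n)
  refine this.trans ?_
  congr 1
  refine Finset.prod_congr rfl fun i _ => ?_
  unfold sg
  simp only [if_true]
  norm_num
  field_simp
  ring

lemma coll_count {n m : ℕ} (i0 : Fin n) (i j : Fin m) (hij : i ≠ j) :
    (Finset.univ.filter (fun y : Fin m → Cube n => canon i0 (y i) = canon i0 (y j))).card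
      ≤ (2 ^ n) ^ (m - 1) * 2 := by
  have hc : Fintype.card (({k : Fin m // k ≠ j} → Cube n) × Bool) = (2 ^ n) ^ (m - 1) * 2 := by
    simp [Fintype.card_subtype_compl]
  rw [← hc, ← Finset.card_univ]
  refine Finset.card_le_card_of_injOn (fun y => (fun k => y k.1, y j i0)) (by simp) ?_
  intro y hy y' hy' h
  simp only [Finset.coe_filter, Finset.mem_univ, true_and, Set.mem_ofPred_eq] at hy hy'
  simp only [Prod.mk.injEq] at h
  have hne : ∀ k, k ≠ j → y k = y' k := fun k hk => congrFun h.1 ⟨k, hk⟩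
  funext k
  by_cases hk : k = j
  · subst hk
    refine canon_eq i0 ?_ h.2
    rw [← hy, ← hy', hne i hij]
  · exact hne k hk

lemma coll_total {n m : ℕ} (hm : 1 ≤ m) (i0 : Fin n)
    (hb : (m : ℝ) * ((m : ℝ) - 1) ≤ (2 : ℝ) ^ n / 100) :
    ∑ y ∈ Finset.univ.filter (fun y : Fin m → Cube n =>
      ¬ Function.Injective (fun i => canon i0 (y i))), ∏ _i : Fin m, ((2 : ℝ) ^ n)⁻¹ ≤ 1 / 50 := by
  have hsub : Finset.univ.filter (fun y : Fin m → Cube n =>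
      ¬ Function.Injective (fun i => canon i0 (y i)))
      ⊆ (Finset.univ : Finset (Fin m)).offDiag.biUnion (fun p =>
        Finset.univ.filter (fun y : Fin m → Cube n => canon i0 (y p.1) = canon i0 (y p.2))) := by
    intro y hy
    simp only [Finset.mem_filter, Finset.mem_univ, true_and, Function.Injective, not_forall] at hy
    obtain ⟨i, j, h, hij⟩ := hy
    exact Finset.mem_biUnion.2 ⟨(i, j), by simp [hij], by simpa using h⟩
  have hcard := (Finset.card_le_card hsub).trans (Finset.card_biUnion_le_card_mul _ _
    ((2 ^ n) ^ (m - 1) * 2) (fun p hp => coll_count i0 p.1 p.2 (Finset.mem_offDiag.1 hp).2.2))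
  rw [Finset.offDiag_card, Finset.card_univ, Fintype.card_fin] at hcard
  have hcard' : ((Finset.univ.filter (fun y : Fin m → Cube n =>
      ¬ Function.Injective (fun i => canon i0 (y i)))).card : ℝ)
      ≤ ((m : ℝ) * ((m : ℝ) - 1)) * (((2 : ℝ) ^ n) ^ (m - 1) * 2) := by
    have h1 : ((m * m - m : ℕ) : ℝ) = (m : ℝ) * ((m : ℝ) - 1) := by
      rw [Nat.cast_sub (Nat.le_mul_of_pos_left m hm)]; push_cast; ring
    rw [← h1]
    exact_mod_cast hcard
  rw [Finset.sum_const, nsmul_eq_mul, Finset.prod_const, Finset.card_univ, Fintype.card_fin]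
  have hN : (0 : ℝ) < 2 ^ n := by positivity
  obtain ⟨k, rfl⟩ : ∃ k, m = k + 1 := ⟨m - 1, by omega⟩
  simp only [Nat.add_sub_cancel] at hcard'
  rw [inv_pow, ← div_eq_mul_inv, div_le_iff₀ (by positivity)]
  refine hcard'.trans ?_
  calc _ ≤ (2 : ℝ) ^ n / 100 * (((2 : ℝ) ^ n) ^ k * 2) :=
        mul_le_mul_of_nonneg_right hb (by positivity)
    _ = _ := by rw [pow_succ]; ring

lemma DD_nonneg {n : ℕ} (i0 : Fin n) (f : Cube n → Bool) (x : Cube n) : 0 ≤ DD i0 f x := by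
  unfold DD
  apply div_nonneg _ (by positivity)
  rcases ep_cases i0 f x with h | h <;> rw [h] <;> norm_num

lemma DD_sum {n : ℕ} (i0 : Fin n) (f : Cube n → Bool) : ∑ x, DD i0 f x = 1 := by
  have h := sum_ep_free i0 (fun _ => none) rfl f
  have hs : sub (fun _ : Fin n => none) = Finset.univ := by
    ext x; simp [sub, Consistent]
  rw [hs] at h
  unfold DD
  rw [← Finset.sum_div, Finset.sum_add_distrib, h]
  simp

end DepthLB

open DepthLB in
/-- impossibility of determining the depth of a distribution using few random
samples: no `m`-sample tester distinguishes the uniform distribution from all distributions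
robustly requiring depth `d`, when `m(m−1) ≤ 2^n/100` and `2^{n−d} ≥ 18·ln(200·3^n)`. -/
theorem no_uniformity_vs_depth_tester
    (n m d : ℕ) (hn : 1 ≤ n) (hm : 1 ≤ m) (hd1 : 1 ≤ d) (hdn : d ≤ n)
    (hbirthday : (m : ℝ) * ((m : ℝ) - 1) ≤ (2 : ℝ) ^ n / 100)
    (hdepth : 18 * Real.log (200 * 3 ^ n) ≤ (2 : ℝ) ^ (n - d)) :
    ¬ ∃ A : (Fin m → Cube n) → ℝ,
        (∀ y, 0 ≤ A y ∧ A y ≤ 1) ∧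
        (2 / 3 : ℝ) ≤ (∑ y : Fin m → Cube n, (∏ _i : Fin m, ((2 : ℝ) ^ n)⁻¹) * A y) ∧
        (∀ D : Cube n → ℝ, (∀ x, 0 ≤ D x) → (∑ x : Cube n, D x = 1) →
          RobustlyRequiresDepth n D d →
          (2 / 3 : ℝ) ≤ ∑ y : Fin m → Cube n, (∏ i : Fin m, D (y i)) * (1 - A y)) := by
  rintro ⟨A, hA, hunif, htest⟩
  let i0 : Fin n := ⟨0, hn⟩
  set F : ℝ := (Fintype.card (Cube n → Bool) : ℝ) with hF
  have hF0 : 0 < F := Nat.cast_pos.2 Fintype.card_pos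
  let good : (Cube n → Bool) → Prop := fun f => ∀ ρ : Rst n, rdepth ρ ≤ d →
      |∑ x ∈ sub ρ, ep i0 f x| < ((sub ρ).card : ℝ) / 3
  let Q : (Cube n → Bool) → ℝ := fun f => ∑ y : Fin m → Cube n,
    (∏ i : Fin m, DD i0 f (y i)) * (1 - A y)
  have hprod : ∀ f, ∑ y : Fin m → Cube n, ∏ i : Fin m, DD i0 f (y i) = 1 := by
    intro f
    have h3 := Finset.prod_univ_sum (fun _ : Fin m => (Finset.univ : Finset (Cube n)))
      (fun _ x => DD i0 f x)
    simp only [Fintype.piFinset_univ, DD_sum] at h3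
    rw [← h3]; simp
  have hpn : ∀ f (y : Fin m → Cube n), 0 ≤ ∏ i : Fin m, DD i0 f (y i) :=
    fun f y => Finset.prod_nonneg fun i _ => DD_nonneg i0 f _
  have hQ0 : ∀ f, 0 ≤ Q f := fun f => Finset.sum_nonneg fun y _ =>
    mul_nonneg (hpn f y) (by linarith [(hA y).2])
  have hQg : ∀ f, good f → 2 / 3 ≤ Q f := fun f hf =>
    htest _ (DD_nonneg i0 f) (DD_sum i0 f) (robust i0 f hf)
  -- lower bound on the average rejection probability
  have hlow : 2 / 3 * (99 / 100 * F) ≤ ∑ f, Q f := by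
    have hbad := bad_count i0 hdepth
    rw [← hF] at hbad
    have hsplit := Finset.card_filter_add_card_filter_not
      (s := (Finset.univ : Finset (Cube n → Bool))) good
    have hsplit' : ((Finset.univ.filter good).card : ℝ)
        + ((Finset.univ.filter (fun f => ¬ good f)).card : ℝ) = F := by
      rw [hF, ← Finset.card_univ]; exact_mod_cast hsplit
    have hg : 99 / 100 * F ≤ ((Finset.univ.filter good).card : ℝ) := by
      have : ((Finset.univ.filter (fun f => ¬ good f)).card : ℝ) ≤ F / 100 := hbad
      linarith
    calc 2 / 3 * (99 / 100 * F) ≤ ((Finset.univ.filter good).card : ℝ) * (2 / 3) := by linarith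
      _ = ∑ f ∈ Finset.univ.filter good, (2 / 3 : ℝ) := by simp
      _ ≤ ∑ f ∈ Finset.univ.filter good, Q f :=
          Finset.sum_le_sum fun f hf => hQg f (Finset.mem_filter.1 hf).2
      _ ≤ _ := Finset.sum_le_sum_of_subset_of_nonneg (Finset.subset_univ _) fun f _ _ => hQ0 f
  -- upper bound
  let inj : (Fin m → Cube n) → Prop := fun y => Function.Injective (fun i => canon i0 (y i))
  have hQ : ∑ f, Q f = F - ∑ y : Fin m → Cube n, (∑ f, ∏ i : Fin m, DD i0 f (y i)) * A y := by
    have : ∀ f, Q f = 1 - ∑ y : Fin m → Cube n, (∏ i : Fin m, DD i0 f (y i)) * A y := by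
      intro f
      simp only [Q, mul_sub, mul_one, Finset.sum_sub_distrib, hprod]
    simp_rw [this]
    rw [Finset.sum_sub_distrib, Finset.sum_comm]
    simp only [Finset.sum_mul]
    simp [hF]
  have hsplit := Finset.sum_filter_add_sum_filter_not (Finset.univ : Finset (Fin m → Cube n)) inj
    (fun y => (∏ _i : Fin m, ((2 : ℝ) ^ n)⁻¹) * A y)
  have hcoll : ∑ y ∈ Finset.univ.filter (fun y => ¬ inj y),
      (∏ _i : Fin m, ((2 : ℝ) ^ n)⁻¹) * A y ≤ 1 / 50 :=
    (Finset.sum_le_sum fun y _ => mul_le_of_le_one_right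
      (Finset.prod_nonneg fun _ _ => by positivity) (hA y).2).trans (coll_total hm i0 hbirthday)
  have hmain : F * ∑ y ∈ Finset.univ.filter inj, (∏ _i : Fin m, ((2 : ℝ) ^ n)⁻¹) * A y
      ≤ ∑ y : Fin m → Cube n, (∑ f, ∏ i : Fin m, DD i0 f (y i)) * A y := by
    rw [Finset.mul_sum]
    calc _ = ∑ y ∈ Finset.univ.filter inj, (∑ f, ∏ i : Fin m, DD i0 f (y i)) * A y := by
          refine Finset.sum_congr rfl fun y hy => ?_
          rw [distinct_avg i0 y (Finset.mem_filter.1 hy).2, ← hF]; ring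
      _ ≤ _ := Finset.sum_le_sum_of_subset_of_nonneg (Finset.subset_univ _) fun y _ _ =>
          mul_nonneg (Finset.sum_nonneg fun f _ => hpn f y) (hA y).1
  have hge : (2 / 3 - 1 / 50 : ℝ)
      ≤ ∑ y ∈ Finset.univ.filter inj, (∏ _i : Fin m, ((2 : ℝ) ^ n)⁻¹) * A y := by linarith
  have := mul_le_mul_of_nonneg_left hge hF0.le
  linarith
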